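/- arXiv:1908.10215 — 2 statements merged into one kernel-verified Lean document; each statement's English description precedes it below -/
import Mathlib

section
/- For every integer k ≥ 3, the diagonal Ramsey number satisfies R(k,k) ≥ (√2)^k; that is, for every positive integer n with n ≤ 2^(k/2) there exists a two-coloring of the edges of the complete graph on n vertices containing no monochromatic clique on k vertices. -/
/-- An edge coloring of the complete graph on `Fin n`: each 2-element subset of
vertices (edge) is colored with one of two colors (`true` = red, `false` = blue). -/
abbrev EdgeColoring (n : ℕ) : Type := {e : Finset (Fin n) // e.card = 2} → Bool

/-- The coloring `c` contains a monochromatic clique of color `b` on `m` vertices. -/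
def HasMonoClique {n : ℕ} (c : EdgeColoring n) (b : Bool) (m : ℕ) : Prop :=
  ∃ S : Finset (Fin n), S.card = m ∧
    ∀ e : {e : Finset (Fin n) // e.card = 2}, (e : Finset (Fin n)) ⊆ S → c e = b

/-- The Ramsey number `R(m, n)`: the least positive integer `N` such that every
red/blue edge coloring of the complete graph on `N` vertices contains a red clique
on `m` vertices or a blue clique on `n` vertices. -/
noncomputable def ramseyNumber (m n : ℕ) : ℕ :=
  sInf {N : ℕ | 0 < N ∧ ∀ c : EdgeColoring N,
    HasMonoClique c true m ∨ HasMonoClique c false n}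

/-- A weak form of Ramsey's theorem for graphs, relative to a finite set of vertices. -/
theorem exists_isClique_or_isIndepSet {V : Type*} (G : SimpleGraph V) (a b : ℕ)
    (s : Finset V) (hs : 2 ^ (a + b) ≤ s.card) :
    ∃ t ⊆ s, (t.card = a ∧ G.IsClique t) ∨ (t.card = b ∧ G.IsIndepSet t) := by
  classical
  induction a generalizing b s with
  | zero => exact ⟨∅, by simp, Or.inl (by simp)⟩
  | succ a iha =>
    induction b generalizing s with
    | zero => exact ⟨∅, by simp, Or.inr (by simp)⟩
    | succ b ihb =>
      obtain ⟨v, hv⟩ : s.Nonempty :=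
        Finset.card_pos.mp (lt_of_lt_of_le (by positivity) hs)
      have hsplit := Finset.card_filter_add_card_filter_not (s := s.erase v) (G.Adj v)
      rw [Finset.card_erase_of_mem hv] at hsplit
      have hpow : 2 ^ (a + 1 + (b + 1)) = 2 * 2 ^ (a + (b + 1)) := by ring
      have hpow' : a + 1 + b = a + (b + 1) := by ring
      rcases le_or_gt (2 ^ (a + (b + 1))) ((s.erase v).filter (G.Adj v)).card with h | h
      · obtain ⟨t, hts, ⟨hc, ht⟩ | ht⟩ := iha (b + 1) _ h
        · have hvt : v ∉ t := fun hvt => by simpa using hts hvt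
          refine ⟨insert v t, ?_, Or.inl ⟨by simp [hvt, hc], ?_⟩⟩
          · refine Finset.insert_subset hv (hts.trans ?_)
            exact (Finset.filter_subset _ _).trans (Finset.erase_subset _ _)
          · rw [Finset.coe_insert]
            exact ht.insert fun w hw _ => (Finset.mem_filter.mp (hts hw)).2
        · exact ⟨t, hts.trans ((Finset.filter_subset _ _).trans (Finset.erase_subset _ _)),
            Or.inr ht⟩
      · have h' : 2 ^ (a + 1 + b) ≤ ((s.erase v).filter (fun w => ¬ G.Adj v w)).card := by
          rw [hpow']
          omega
        obtain ⟨t, hts, ht | ⟨hc, ht⟩⟩ := ihb _ h'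
        · exact ⟨t, hts.trans ((Finset.filter_subset _ _).trans (Finset.erase_subset _ _)),
            Or.inl ht⟩
        · have hvt : v ∉ t := fun hvt => by simpa using hts hvt
          refine ⟨insert v t, ?_, Or.inr ⟨by simp [hvt, hc], ?_⟩⟩
          · refine Finset.insert_subset hv (hts.trans ?_)
            exact (Finset.filter_subset _ _).trans (Finset.erase_subset _ _)
          · rw [Finset.coe_insert]
            refine Set.Pairwise.insert ht fun w hw _ => ?_
            have hvw := (Finset.mem_filter.mp (hts hw)).2
            exact ⟨hvw, fun h => hvw h.symm⟩

/-- The graph formed by the red edges of a coloring. -/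
def EdgeColoring.redGraph {n : ℕ} (c : EdgeColoring n) : SimpleGraph (Fin n) where
  Adj x y := ∃ h : ({x, y} : Finset (Fin n)).card = 2, c ⟨{x, y}, h⟩ = true
  symm := ⟨fun x y h => by simpa only [Finset.pair_comm y x] using h⟩
  loopless := ⟨fun x h => by simpa using h.1⟩

theorem hasMonoClique_true_or_false (m n : ℕ) (c : EdgeColoring (2 ^ (m + n))) :
    HasMonoClique c true m ∨ HasMonoClique c false n := by
  obtain ⟨t, -, ⟨hc, ht⟩ | ⟨hc, ht⟩⟩ :=
    exists_isClique_or_isIndepSet c.redGraph m n Finset.univ (by simp)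
  · refine Or.inl ⟨t, hc, fun ⟨e, he⟩ hsub => ?_⟩
    obtain ⟨x, y, hxy, rfl⟩ := Finset.card_eq_two.mp he
    exact (ht (hsub (by simp)) (hsub (by simp)) hxy).2
  · refine Or.inr ⟨t, hc, fun ⟨e, he⟩ hsub => ?_⟩
    obtain ⟨x, y, hxy, rfl⟩ := Finset.card_eq_two.mp he
    exact Bool.eq_false_iff.mpr fun h =>
      ht (hsub (by simp)) (hsub (by simp)) hxy ⟨he, h⟩

theorem ramseyNumber_spec (m n : ℕ) :
    0 < ramseyNumber m n ∧ ∀ c : EdgeColoring (ramseyNumber m n),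
      HasMonoClique c true m ∨ HasMonoClique c false n :=
  Nat.sInf_mem (s := {N : ℕ | 0 < N ∧ ∀ c : EdgeColoring N,
    HasMonoClique c true m ∨ HasMonoClique c false n})
    ⟨2 ^ (m + n), by positivity, hasMonoClique_true_or_false m n⟩

/-- The number of two-colorings of `α` that are constantly `b` on `A`. -/
theorem card_filter_forall_mem_eq {α : Type*} [Fintype α] [DecidableEq α] (A : Finset α)
    (b : Bool) :
    (Finset.univ.filter fun c : α → Bool => ∀ e ∈ A, c e = b).card * 2 ^ A.card =
      2 ^ Fintype.card α := by
  have h : (Finset.univ.filter fun c : α → Bool => ∀ e ∈ A, c e = b) =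
      Fintype.piFinset fun e => if e ∈ A then {b} else Finset.univ := by
    ext c
    simp only [Finset.mem_filter, Finset.mem_univ, true_and, Fintype.mem_piFinset]
    refine forall_congr' fun e => ?_
    split_ifs with he <;> simp [he]
  have hcard : ∀ e, (if e ∈ A then {b} else Finset.univ : Finset Bool).card =
      if e ∈ A then 1 else 2 := fun e => by split_ifs <;> simp
  rw [h, Fintype.card_piFinset, Finset.prod_congr rfl fun e _ => hcard e, Finset.prod_ite]
  simp only [Finset.prod_const, one_pow, one_mul, ← pow_add]
  congr 1
  have := Finset.card_filter_add_card_filter_not (s := (Finset.univ : Finset α)) (· ∈ A)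
  simp only [Finset.filter_univ_mem, Finset.card_univ] at this
  omega

theorem card_edges_subset {n : ℕ} (S : Finset (Fin n)) :
    (Finset.univ.filter fun e : {e : Finset (Fin n) // e.card = 2} =>
      (e : Finset (Fin n)) ⊆ S).card = S.card.choose 2 := by
  rw [← Finset.card_powersetCard, ← Finset.card_map (Function.Embedding.subtype _)]
  congr 1
  ext e
  simp [Finset.mem_powersetCard, and_comm]

/-- The union bound of Erdős. -/
theorem exists_coloring_of_two_mul_choose_lt {n k : ℕ} (h : 2 * n.choose k < 2 ^ k.choose 2) :
    ∃ c : EdgeColoring n, ∀ b : Bool, ¬ HasMonoClique c b k := by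
  classical
  by_contra! hcon
  let A (S : Finset (Fin n)) : Finset {e : Finset (Fin n) // e.card = 2} :=
    Finset.univ.filter fun e => (e : Finset (Fin n)) ⊆ S
  let B (p : Finset (Fin n) × Bool) : Finset (EdgeColoring n) :=
    Finset.univ.filter fun c => ∀ e ∈ A p.1, c e = p.2
  let I := Finset.powersetCard k (Finset.univ : Finset (Fin n)) ×ˢ (Finset.univ : Finset Bool)
  have hcover : (Finset.univ : Finset (EdgeColoring n)) ⊆ I.biUnion B := by
    intro c _
    obtain ⟨b, S, hS, hc⟩ := hcon c
    refine Finset.mem_biUnion.mpr ⟨(S, b), ?_, ?_⟩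
    · simp [I, Finset.mem_powersetCard, hS]
    · simpa [B, A] using hc
  have hB : ∀ p ∈ I, (B p).card * 2 ^ k.choose 2 = Fintype.card (EdgeColoring n) := by
    intro p hp
    have hp' : p.1.card = k := by simpa [I, Finset.mem_powersetCard] using hp
    have hA : (A p.1).card = k.choose 2 := by rw [← hp']; exact card_edges_subset p.1
    rw [← hA, card_filter_forall_mem_eq]
    simp [EdgeColoring]
  have hI : I.card = 2 * n.choose k := by simp [I, Finset.card_powersetCard, mul_comm]
  have hle := (Finset.card_le_card hcover).trans Finset.card_biUnion_le
  have hmul := Nat.mul_le_mul_right (2 ^ k.choose 2) hle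
  rw [Finset.sum_mul, Finset.sum_congr rfl hB, Finset.sum_const, hI, Finset.card_univ,
    smul_eq_mul, mul_comm] at hmul
  exact absurd (Nat.le_of_mul_le_mul_right hmul Fintype.card_pos) (not_le.mpr h)

theorem two_pow_add_two_lt_factorial_sq {k : ℕ} (hk : 3 ≤ k) :
    2 ^ (k + 2) < k.factorial ^ 2 := by
  induction k, hk using Nat.le_induction with
  | base => decide
  | succ k hk ih =>
    rw [Nat.factorial_succ, mul_pow, show k + 1 + 2 = (k + 2) + 1 by ring, pow_succ, mul_comm]
    exact Nat.mul_lt_mul_of_le_of_lt (by nlinarith) ih (by positivity)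

theorem two_mul_choose_lt_two_pow {n k : ℕ} (hk : 3 ≤ k) (hn : n ^ 2 ≤ 2 ^ k) :
    2 * n.choose k < 2 ^ k.choose 2 := by
  have hchoose : n.choose k * k.factorial ≤ n ^ k := by
    rw [mul_comm, ← Nat.descFactorial_eq_factorial_mul_choose]
    exact Nat.descFactorial_le_pow n k
  have hexp : k.choose 2 * 2 + k = k * k := by
    rw [Nat.choose_two_right, Nat.div_mul_cancel (Nat.even_mul_pred_self k).two_dvd,
      Nat.mul_sub_one]
    exact Nat.sub_add_cancel (Nat.le_mul_self k)
  refine lt_of_pow_lt_pow_left₀ 2 (by positivity) ?_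
  refine lt_of_mul_lt_mul_right (a := k.factorial ^ 2) ?_ (by positivity)
  calc (2 * n.choose k) ^ 2 * k.factorial ^ 2
      = 4 * (n.choose k * k.factorial) ^ 2 := by ring
    _ ≤ 4 * (n ^ k) ^ 2 := by gcongr
    _ = 4 * (n ^ 2) ^ k := by rw [← pow_mul, ← pow_mul, mul_comm k]
    _ ≤ 4 * (2 ^ k) ^ k := by gcongr
    _ = (2 ^ k.choose 2) ^ 2 * 2 ^ (k + 2) := by
      rw [← pow_mul, ← pow_mul, ← hexp]
      ring
    _ < (2 ^ k.choose 2) ^ 2 * k.factorial ^ 2 := by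
      gcongr
      exact two_pow_add_two_lt_factorial_sq hk

theorem sqrt_two_pow_eq_rpow (k : ℕ) : Real.sqrt 2 ^ k = 2 ^ ((k : ℝ) / 2) := by
  rw [Real.sqrt_eq_rpow, ← Real.rpow_natCast, ← Real.rpow_mul zero_le_two]
  congr 1
  ring

theorem ramsey_diagonal_lower (k : ℕ) (hk : 3 ≤ k) :
    Real.sqrt 2 ^ k ≤ (ramseyNumber k k : ℝ) ∧
    ∀ n : ℕ, 0 < n → (n : ℝ) ≤ 2 ^ ((k : ℝ) / 2) →
      ∃ c : EdgeColoring n, ∀ b : Bool, ¬ HasMonoClique c b k := by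
  have hcol : ∀ n : ℕ, 0 < n → (n : ℝ) ≤ 2 ^ ((k : ℝ) / 2) →
      ∃ c : EdgeColoring n, ∀ b : Bool, ¬ HasMonoClique c b k := by
    intro n _ hn
    refine exists_coloring_of_two_mul_choose_lt (two_mul_choose_lt_two_pow hk ?_)
    rw [← sqrt_two_pow_eq_rpow] at hn
    have hsq : (n : ℝ) ^ 2 ≤ 2 ^ k := by
      calc (n : ℝ) ^ 2 ≤ (Real.sqrt 2 ^ k) ^ 2 := by gcongr
        _ = 2 ^ k := by rw [← pow_mul, mul_comm, pow_mul, Real.sq_sqrt zero_le_two]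
    exact_mod_cast hsq
  refine ⟨?_, hcol⟩
  by_contra! hlt
  obtain ⟨hpos, hR⟩ := ramseyNumber_spec k k
  obtain ⟨c, hc⟩ := hcol _ hpos (hlt.le.trans_eq (sqrt_two_pow_eq_rpow k))
  exact (hR c).elim (hc true) (hc false)
end

section
/- Fix an integer k ≥ 3 and let μ = E[X]. As n → ∞, the fourth central moment E[(X − μ)⁴] is asymptotically equivalent to (3/4) · (1/((k−3)!)⁴) · n^(4k−6) / 2^(4·C(k,2) − 4), i.e., the ratio of the two quantities tends to 1. -/
/-- `X`: the number of `k`-element vertex subsets all of whose induced edges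
receive the same color (monochromatic `K_k`) in the coloring `c`. -/
def monoCount (n k : ℕ) (c : EdgeColoring n) : ℕ :=
  ((Finset.univ.powersetCard k).filter (fun S : Finset (Fin n) => ∃ b : Bool,
    ∀ e : {e : Finset (Fin n) // e.card = 2}, (e : Finset (Fin n)) ⊆ S → c e = b)).card

/-- Expectation of `f` under the uniform distribution on all edge colorings. -/
noncomputable def expec (n : ℕ) (f : EdgeColoring n → ℝ) : ℝ :=
  (∑ c : EdgeColoring n, f c) / (Fintype.card (EdgeColoring n) : ℝ)

/-- The `m`-th central moment of the number of monochromatic `K_k`'s in a uniformly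
random edge coloring of the complete graph on `n` vertices. -/
noncomputable def centralMoment (n k m : ℕ) : ℝ :=
  expec n (fun c => ((monoCount n k c : ℝ) -
    expec n (fun c' => (monoCount n k c' : ℝ))) ^ m)

open Finset Filter Topology
open scoped symmDiff

section RademacherFourier

variable {ι : Type*}

/-- The Rademacher sign of a colour. -/
def boolSign (b : Bool) : ℝ := if b then 1 else -1

lemma boolSign_mul_self (b : Bool) : boolSign b * boolSign b = 1 := by
  cases b <;> simp [boolSign]

lemma boolSign_not (b : Bool) : boolSign (!b) = -boolSign b := by
  cases b <;> simp [boolSign]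

/-- The Walsh character indexed by `F`. -/
def walsh (F : Finset ι) (c : ι → Bool) : ℝ := ∏ e ∈ F, boolSign (c e)

@[simp]
lemma walsh_empty (c : ι → Bool) : walsh ∅ c = 1 := by simp [walsh]

variable [DecidableEq ι]

lemma walsh_mul_walsh (F G : Finset ι) (c : ι → Bool) :
    walsh F c * walsh G c = walsh (F ∆ G) c := by
  have key (s : Finset ι) (hs : s ⊆ F ∪ G) :
      walsh s c = ∏ e ∈ F ∪ G, if e ∈ s then boolSign (c e) else 1 := by
    rw [prod_ite_mem, inter_eq_right.2 hs, walsh]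
  rw [key F subset_union_left, key G subset_union_right, key (F ∆ G) symmDiff_le_sup,
    ← prod_mul_distrib]
  refine prod_congr rfl fun e _ ↦ ?_
  by_cases h₁ : e ∈ F <;> by_cases h₂ : e ∈ G <;>
    simp [h₁, h₂, mem_symmDiff, boolSign_mul_self]

/-- Changing the colour of the coordinate `i`. -/
def flipAt (i : ι) : (ι → Bool) ≃ (ι → Bool) :=
  Function.Involutive.toPerm (fun c ↦ Function.update c i (!c i)) fun c ↦ by simp

lemma boolSign_flipAt (i : ι) (c : ι → Bool) :
    boolSign (flipAt i c i) = -boolSign (c i) := by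
  simp [flipAt, Function.Involutive.toPerm, boolSign_not]

lemma walsh_flipAt_of_notMem {i : ι} {F : Finset ι} (hi : i ∉ F) (c : ι → Bool) :
    walsh F (flipAt i c) = walsh F c := by
  refine prod_congr rfl fun e he ↦ ?_
  have : e ≠ i := fun h ↦ hi (h ▸ he)
  simp [flipAt, Function.Involutive.toPerm, this]

lemma walsh_insert {i : ι} {F : Finset ι} (hi : i ∉ F) (c : ι → Bool) :
    walsh (insert i F) c = boolSign (c i) * walsh F c := prod_insert hi

lemma walsh_flipAt_of_mem {i : ι} {F : Finset ι} (hi : i ∈ F) (c : ι → Bool) :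
    walsh F (flipAt i c) = -walsh F c := by
  rw [← insert_erase hi, walsh_insert (notMem_erase i F), walsh_insert (notMem_erase i F),
    walsh_flipAt_of_notMem (notMem_erase i F), boolSign_flipAt, neg_mul]

variable [Fintype ι]

/-- The average of a function over all two-colourings of `ι`. -/
noncomputable def colorAvg (f : (ι → Bool) → ℝ) : ℝ :=
  (∑ c, f c) / (Fintype.card (ι → Bool) : ℝ)

lemma colorAvg_add (f g : (ι → Bool) → ℝ) :
    colorAvg (fun c ↦ f c + g c) = colorAvg f + colorAvg g := by
  simp only [colorAvg, sum_add_distrib, add_div]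

lemma colorAvg_const_mul (a : ℝ) (f : (ι → Bool) → ℝ) :
    colorAvg (fun c ↦ a * f c) = a * colorAvg f := by
  simp only [colorAvg, ← mul_sum, mul_div_assoc]

lemma colorAvg_sum {κ : Type*} (s : Finset κ) (f : κ → (ι → Bool) → ℝ) :
    colorAvg (fun c ↦ ∑ j ∈ s, f j c) = ∑ j ∈ s, colorAvg (f j) := by
  simp only [colorAvg, sum_div]
  rw [sum_comm]

lemma colorAvg_nonneg {f : (ι → Bool) → ℝ} (hf : ∀ c, 0 ≤ f c) : 0 ≤ colorAvg f :=
  div_nonneg (sum_nonneg fun c _ ↦ hf c) (Nat.cast_nonneg _)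

lemma colorAvg_const (a : ℝ) : colorAvg (fun _ : ι → Bool ↦ a) = a := by
  simp [colorAvg]

lemma colorAvg_comp_flipAt (i : ι) (f : (ι → Bool) → ℝ) :
    colorAvg (fun c ↦ f (flipAt i c)) = colorAvg f := by
  rw [colorAvg, Equiv.sum_comp (flipAt i) f, colorAvg]

lemma sq_colorAvg_mul_le (f g : (ι → Bool) → ℝ) :
    colorAvg (fun c ↦ f c * g c) ^ 2 ≤
      colorAvg (fun c ↦ f c ^ 2) * colorAvg (fun c ↦ g c ^ 2) := by
  simp only [colorAvg, div_pow, div_mul_div_comm, ← sq]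
  gcongr
  exact sum_mul_sq_le_sq_mul_sq univ f g

lemma colorAvg_walsh (F : Finset ι) : colorAvg (walsh F) = if F = ∅ then 1 else 0 := by
  split_ifs with h
  · subst h
    simpa only [funext walsh_empty] using colorAvg_const (ι := ι) 1
  · obtain ⟨i, hi⟩ := nonempty_iff_ne_empty.2 h
    have h₁ := colorAvg_comp_flipAt i (walsh F)
    simp only [walsh_flipAt_of_mem hi] at h₁
    have h₂ := colorAvg_const_mul (-1) (walsh F)
    simp only [neg_one_mul] at h₂
    linarith

/-- A form of the Bonami hypercontractive inequality. -/
lemma colorAvg_pow_four_le (T : Finset ι) (a : Finset ι → ℝ) :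
    colorAvg (fun c ↦ (∑ F ∈ T.powerset, a F * walsh F c) ^ 4) ≤
      (∑ F ∈ T.powerset, 3 ^ #F * a F ^ 2) ^ 2 := by
  induction T using Finset.induction_on generalizing a with
  | empty => simp [colorAvg_const, ← pow_mul]
  | insert i T hi ih =>
    set h : (ι → Bool) → ℝ := fun c ↦ ∑ F ∈ T.powerset, a F * walsh F c with hh
    set g : (ι → Bool) → ℝ := fun c ↦ ∑ F ∈ T.powerset, a (insert i F) * walsh F c with hg
    have hmem {F : Finset ι} (hF : F ∈ T.powerset) : i ∉ F := fun hiF ↦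
      hi (mem_powerset.1 hF hiF)
    have split (c : ι → Bool) :
        ∑ F ∈ (insert i T).powerset, a F * walsh F c = h c + boolSign (c i) * g c := by
      rw [sum_powerset_insert hi, hh, hg, mul_sum]
      congr 1
      refine sum_congr rfl fun F hF ↦ ?_
      rw [walsh_insert (hmem hF)]
      ring
    have hflip (c : ι → Bool) : h (flipAt i c) = h c :=
      sum_congr rfl fun F hF ↦ by rw [walsh_flipAt_of_notMem (hmem hF)]
    have gflip (c : ι → Bool) : g (flipAt i c) = g c :=
      sum_congr rfl fun F hF ↦ by rw [walsh_flipAt_of_notMem (hmem hF)]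
    have expand : colorAvg (fun c ↦ (h c + boolSign (c i) * g c) ^ 4) =
        colorAvg (fun c ↦ h c ^ 4) + 6 * colorAvg (fun c ↦ h c ^ 2 * g c ^ 2) +
          colorAvg (fun c ↦ g c ^ 4) := by
      have h₁ := colorAvg_comp_flipAt i (fun c ↦ (h c + boolSign (c i) * g c) ^ 4)
      simp only [hflip, gflip, boolSign_flipAt] at h₁
      have h₂ : colorAvg (fun c ↦ (h c + -boolSign (c i) * g c) ^ 4) +
          colorAvg (fun c ↦ (h c + boolSign (c i) * g c) ^ 4) =
          2 * (colorAvg (fun c ↦ h c ^ 4) + 6 * colorAvg (fun c ↦ h c ^ 2 * g c ^ 2) +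
            colorAvg (fun c ↦ g c ^ 4)) := by
        rw [← colorAvg_const_mul 6, ← colorAvg_add, ← colorAvg_add, ← colorAvg_add,
          ← colorAvg_const_mul]
        congr 1
        funext c
        have hs : boolSign (c i) ^ 2 = 1 := by rw [sq, boolSign_mul_self]
        have hs₄ : boolSign (c i) ^ 4 = 1 := by
          rw [show 4 = 2 * 2 from rfl, pow_mul, hs, one_pow]
        linear_combination 12 * h c ^ 2 * g c ^ 2 * hs + 2 * g c ^ 4 * hs₄
      linarith
    have hnn (b : Finset ι → ℝ) : 0 ≤ ∑ F ∈ T.powerset, 3 ^ #F * b F ^ 2 :=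
      sum_nonneg fun F _ ↦ by positivity
    have hH := ih a
    have hG := ih fun F ↦ a (insert i F)
    set H := ∑ F ∈ T.powerset, 3 ^ #F * a F ^ 2 with hHdef
    set G := ∑ F ∈ T.powerset, 3 ^ #F * a (insert i F) ^ 2 with hGdef
    have hH₀ : 0 ≤ H := hnn a
    have hG₀ : 0 ≤ G := hnn fun F ↦ a (insert i F)
    have rhs : ∑ F ∈ (insert i T).powerset, 3 ^ #F * a F ^ 2 = H + 3 * G := by
      rw [sum_powerset_insert hi, hGdef, mul_sum]
      congr 1
      refine sum_congr rfl fun F hF ↦ ?_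
      rw [card_insert_of_notMem (hmem hF)]
      ring
    have cross : colorAvg (fun c ↦ h c ^ 2 * g c ^ 2) ≤ H * G := by
      refine abs_le_of_sq_le_sq' ?_ (mul_nonneg hH₀ hG₀) |>.2
      refine (sq_colorAvg_mul_le _ _).trans ?_
      simp only [← pow_mul, Nat.reduceMul, mul_pow]
      exact mul_le_mul hH hG (colorAvg_nonneg fun c ↦ Even.pow_nonneg ⟨2, rfl⟩ _) (sq_nonneg H)
    simp only [split]
    rw [expand, rhs]
    have := mul_nonneg hH₀ hG₀
    nlinarith [sq_nonneg G]

/-- The fourth moment of a sum of distinct Walsh characters counts the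
quadruples of index sets whose symmetric difference is empty. -/
lemma colorAvg_sum_walsh_pow_four (L : Finset (Finset ι)) :
    colorAvg (fun c ↦ (∑ F ∈ L, walsh F c) ^ 4) =
      ∑ F₁ ∈ L, ∑ F₂ ∈ L, ∑ F₃ ∈ L, ∑ F₄ ∈ L,
        if F₁ ∆ F₂ ∆ F₃ ∆ F₄ = ∅ then (1 : ℝ) else 0 := by
  have expand (c : ι → Bool) : (∑ F ∈ L, walsh F c) ^ 4 =
      ∑ F₁ ∈ L, ∑ F₂ ∈ L, ∑ F₃ ∈ L, ∑ F₄ ∈ L, walsh (F₁ ∆ F₂ ∆ F₃ ∆ F₄) c := by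
    simp only [← walsh_mul_walsh, ← mul_sum, ← sum_mul]
    ring
  simp only [expand, colorAvg_sum, colorAvg_walsh]

end RademacherFourier

section CompleteGraphEdges

/-- The edges of the complete graph on `Fin n`. -/
abbrev CompleteEdge (n : ℕ) : Type := {e : Finset (Fin n) // e.card = 2}

variable {n : ℕ}

/-- The vertices covered by a set of edges. -/
def vertexSupport (F : Finset (CompleteEdge n)) : Finset (Fin n) := F.biUnion Subtype.val

/-- The edges with both ends in `S`. -/
def edgesIn (S : Finset (Fin n)) : Finset (CompleteEdge n) := univ.filter fun e ↦ e.1 ⊆ S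

lemma mem_edgesIn {S : Finset (Fin n)} {e : CompleteEdge n} : e ∈ edgesIn S ↔ e.1 ⊆ S := by
  simp [edgesIn]

lemma subset_edgesIn {F : Finset (CompleteEdge n)} {S : Finset (Fin n)} :
    F ⊆ edgesIn S ↔ vertexSupport F ⊆ S := by
  simp only [vertexSupport, biUnion_subset]
  exact forall₂_congr fun _ _ ↦ mem_edgesIn

lemma card_edgesIn (S : Finset (Fin n)) : #(edgesIn S) = (#S).choose 2 := by
  rw [← card_powersetCard, ← card_map (Function.Embedding.subtype _)]
  congr 1
  ext e
  simp [edgesIn, mem_powersetCard, and_comm]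

lemma card_le_choose_vertexSupport (F : Finset (CompleteEdge n)) :
    #F ≤ (#(vertexSupport F)).choose 2 :=
  card_edgesIn (vertexSupport F) ▸ card_le_card (subset_edgesIn.2 Subset.rfl)

lemma three_le_card_vertexSupport {F : Finset (CompleteEdge n)} (hF : 2 ≤ #F) :
    3 ≤ #(vertexSupport F) := by
  by_contra! h
  have := (card_le_choose_vertexSupport F).trans (Nat.choose_le_choose 2 (Nat.lt_succ_iff.1 h))
  rw [Nat.choose_self] at this
  omega

lemma vertexSupport_union (F G : Finset (CompleteEdge n)) :
    vertexSupport (F ∪ G) = vertexSupport F ∪ vertexSupport G := union_biUnion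

lemma subset_vertexSupport {F : Finset (CompleteEdge n)} {e : CompleteEdge n} (he : e ∈ F) :
    e.1 ⊆ vertexSupport F := subset_biUnion_of_mem Subtype.val he

/-- The pairs of adjacent edges, written as edge sets. -/
def cherries (n : ℕ) : Finset (Finset (CompleteEdge n)) :=
  univ.filter fun F ↦ #F = 2 ∧ #(vertexSupport F) = 3

lemma mem_cherries {F : Finset (CompleteEdge n)} :
    F ∈ cherries n ↔ #F = 2 ∧ #(vertexSupport F) = 3 := by simp [cherries]

lemma mem_cherries_of_even {F : Finset (CompleteEdge n)} (hF : Even #F)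
    (hV : #(vertexSupport F) = 3) : F ∈ cherries n := by
  refine mem_cherries.2 ⟨?_, hV⟩
  have h := card_le_choose_vertexSupport F
  rw [hV, Nat.choose_two_right] at h
  have h₀ : #F ≠ 0 := by
    intro h0
    rw [card_eq_zero] at h0
    simp [h0, vertexSupport] at hV
  obtain ⟨r, hr⟩ := hF
  omega

lemma card_cherries (n : ℕ) : #(cherries n) = 3 * n.choose 3 := by
  have maps : ∀ F ∈ cherries n, vertexSupport F ∈ powersetCard 3 (univ : Finset (Fin n)) :=
    fun F hF ↦ mem_powersetCard.2 ⟨subset_univ _, (mem_cherries.1 hF).2⟩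
  rw [card_eq_sum_card_fiberwise maps]
  have fiber : ∀ T ∈ powersetCard 3 (univ : Finset (Fin n)),
      #((cherries n).filter fun F ↦ vertexSupport F = T) = 3 := by
    intro T hT
    have hT₃ := (mem_powersetCard.1 hT).2
    have : (cherries n).filter (fun F ↦ vertexSupport F = T) = powersetCard 2 (edgesIn T) := by
      ext F
      rw [mem_filter, mem_cherries, mem_powersetCard, subset_edgesIn]
      constructor
      · rintro ⟨⟨h₂, -⟩, rfl⟩
        exact ⟨Subset.rfl, h₂⟩
      · rintro ⟨hsub, h₂⟩
        have := three_le_card_vertexSupport h₂.ge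
        have hVT := eq_of_subset_of_card_le hsub (hT₃.trans_le this)
        exact ⟨⟨h₂, hVT ▸ hT₃⟩, hVT⟩
    rw [this, card_powersetCard, card_edgesIn, hT₃]
    rfl
  rw [sum_congr rfl fiber, sum_const, card_powersetCard, card_univ, Fintype.card_fin, smul_eq_mul,
    mul_comm]

lemma card_union_vertexSupport_le {A B : Finset (CompleteEdge n)} {e : CompleteEdge n}
    (W : Finset (Fin n)) (hA : A ⊆ edgesIn W) (hB : B ∈ cherries n) (heA : e ∈ A) (heB : e ∈ B) :
    #(W ∪ vertexSupport B) ≤ #W + 1 := by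
  have h₁ := card_union_add_card_inter W (vertexSupport B)
  have h₂ : #e.1 ≤ #(W ∩ vertexSupport B) :=
    card_le_card (subset_inter (mem_edgesIn.1 (hA heA)) (subset_vertexSupport heB))
  rw [e.2] at h₂
  rw [(mem_cherries.1 hB).2] at h₁
  omega

lemma card_vertexSupport_le_five_of_linked {A B C D : Finset (CompleteEdge n)}
    {a b : CompleteEdge n} (hA : A ∈ cherries n) (hB : B ∈ cherries n) (hC : C ∈ cherries n)
    (haA : a ∈ A) (haB : a ∈ B) (hbA : b ∈ A) (hbC : b ∈ C) (hD : D ⊆ A ∪ B ∪ C) :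
    #(vertexSupport (A ∪ B ∪ C ∪ D)) ≤ 5 := by
  rw [union_eq_left.2 hD, vertexSupport_union, vertexSupport_union]
  have h₁ := card_union_vertexSupport_le (vertexSupport A) (subset_edgesIn.2 Subset.rfl)
    hB haA haB
  have h₂ := card_union_vertexSupport_le (vertexSupport A ∪ vertexSupport B)
    (subset_edgesIn.2 subset_union_left) hC hbA hbC
  have := (mem_cherries.1 hA).2
  omega

lemma card_vertexSupport_le_five {A B C D : Finset (CompleteEdge n)}
    (hA : A ∈ cherries n) (hB : B ∈ cherries n) (hC : C ∈ cherries n) (hD : D ∈ cherries n)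
    (h : A ∆ B ∆ C ∆ D = ∅) (hAB : A ≠ B) (hAC : A ≠ C) (hAD : A ≠ D) :
    #(vertexSupport (A ∪ B ∪ C ∪ D)) ≤ 5 := by
  have parity (e : CompleteEdge n) : ¬ e ∈ A ∆ B ∆ C ∆ D := by simp [h]
  simp only [mem_symmDiff] at parity
  have hA₂ := (mem_cherries.1 hA).1
  obtain ⟨a, b, -, hab⟩ := card_eq_two.1 hA₂
  have haA : a ∈ A := by simp [hab]
  have hbA : b ∈ A := by simp [hab]
  have notBoth {G : Finset (CompleteEdge n)} (hG : G ∈ cherries n)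
      (hne : A ≠ G) (haG : a ∈ G) (hbG : b ∈ G) : False :=
    hne (eq_of_subset_of_card_le (by simp [hab, insert_subset_iff, haG, hbG])
      (hA₂.symm ▸ (mem_cherries.1 hG).1.le))
  clear hab
  have ha : a ∈ B ∨ a ∈ C ∨ a ∈ D := by
    have := parity a
    grind
  have hb : b ∈ B ∨ b ∈ C ∨ b ∈ D := by
    have := parity b
    grind
  have subD : D ⊆ A ∪ B ∪ C := fun e he ↦ by
    have := parity e
    grind
  have subC : C ⊆ A ∪ B ∪ D := fun e he ↦ by
    have := parity e
    grind
  have subB : B ⊆ A ∪ C ∪ D := fun e he ↦ by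
    have := parity e
    grind
  have permC : A ∪ B ∪ C ∪ D = A ∪ B ∪ D ∪ C := union_right_comm _ _ _
  have permB : A ∪ B ∪ C ∪ D = A ∪ C ∪ D ∪ B := by
    rw [union_right_comm A B C, union_right_comm]
  rcases ha with ha | ha | ha <;> rcases hb with hb | hb | hb
  · exact (notBoth hB hAB ha hb).elim
  · exact card_vertexSupport_le_five_of_linked hA hB hC haA ha hbA hb subD
  · rw [permC]
    exact card_vertexSupport_le_five_of_linked hA hB hD haA ha hbA hb subC
  · exact card_vertexSupport_le_five_of_linked hA hB hC hbA hb haA ha subD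
  · exact (notBoth hC hAC ha hb).elim
  · rw [permB]
    exact card_vertexSupport_le_five_of_linked hA hC hD haA ha hbA hb subB
  · rw [permC]
    exact card_vertexSupport_le_five_of_linked hA hB hD hbA hb haA ha subC
  · rw [permB]
    exact card_vertexSupport_le_five_of_linked hA hC hD hbA hb haA ha subB
  · exact (notBoth hD hAD ha hb).elim

lemma sum_card_vertexSupport_le_five (hn : 5 ≤ n) (L : Finset (Finset (CompleteEdge n))) :
    (∑ A ∈ L, ∑ B ∈ L, ∑ C ∈ L, ∑ D ∈ L,
      if #(vertexSupport (A ∪ B ∪ C ∪ D)) ≤ 5 then (1 : ℝ) else 0) ≤ 2 ^ 40 * (n : ℝ) ^ 5 := by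
  set bad := (L ×ˢ L ×ˢ L ×ˢ L).filter fun q ↦
    #(vertexSupport (q.1 ∪ q.2.1 ∪ q.2.2.1 ∪ q.2.2.2)) ≤ 5 with hbad
  have hsum : (∑ A ∈ L, ∑ B ∈ L, ∑ C ∈ L, ∑ D ∈ L,
      if #(vertexSupport (A ∪ B ∪ C ∪ D)) ≤ 5 then (1 : ℝ) else 0) = (#bad : ℝ) := by
    rw [hbad, card_filter, Nat.cast_sum]
    simp only [sum_product, Nat.cast_ite, Nat.cast_one, Nat.cast_zero]
  let P (W : Finset (Fin n)) := (edgesIn W).powerset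
  have hsub : bad ⊆ (powersetCard 5 univ).biUnion fun W ↦ P W ×ˢ P W ×ˢ P W ×ˢ P W := by
    intro q hq
    obtain ⟨W, hVW, -, hW⟩ := exists_subsuperset_card_eq (subset_univ _) (mem_filter.1 hq).2
      (by simpa using hn)
    have hsubW := subset_edgesIn.2 hVW
    simp only [union_subset_iff] at hsubW
    simp only [mem_biUnion, mem_product, P, mem_powerset]
    exact ⟨W, mem_powersetCard.2 ⟨subset_univ _, hW⟩, hsubW.1.1.1, hsubW.1.1.2, hsubW.1.2, hsubW.2⟩
  have hcard : #bad ≤ n ^ 5 * 2 ^ 40 := by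
    refine (card_le_card hsub).trans ((card_biUnion_le_card_mul _ _ (2 ^ 40) ?_).trans ?_)
    · intro W hW
      simp only [card_product, P, card_powerset, card_edgesIn, (mem_powersetCard.1 hW).2]
      norm_num [Nat.choose]
    · rw [card_powersetCard, card_univ, Fintype.card_fin]
      exact Nat.mul_le_mul_right _ (Nat.choose_le_pow _ _)
  rw [hsum, mul_comm]
  exact_mod_cast hcard

end CompleteGraphEdges

section PairedSums

variable {κ : Type*} [DecidableEq κ] (L : Finset κ)

lemma sum_paired₁₂ : (∑ A ∈ L, ∑ B ∈ L, ∑ C ∈ L, ∑ D ∈ L,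
    (if A = B then (1 : ℝ) else 0) * (if C = D then 1 else 0)) = (#L : ℝ) ^ 2 := by
  simp [sum_ite_mem, sq]

lemma sum_paired₁₃ : (∑ A ∈ L, ∑ B ∈ L, ∑ C ∈ L, ∑ D ∈ L,
    (if A = C then (1 : ℝ) else 0) * (if B = D then 1 else 0)) = (#L : ℝ) ^ 2 := by
  simp [sum_ite_mem, sq]

lemma sum_paired₁₄ : (∑ A ∈ L, ∑ B ∈ L, ∑ C ∈ L, ∑ D ∈ L,
    (if A = D then (1 : ℝ) else 0) * (if B = C then 1 else 0)) = (#L : ℝ) ^ 2 := by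
  simp [sum_ite_mem, sq]

lemma sum_all_equal : (∑ A ∈ L, ∑ B ∈ L, ∑ C ∈ L, ∑ D ∈ L,
    (if A = B then (1 : ℝ) else 0) * (if A = C then 1 else 0) * (if A = D then 1 else 0)) =
      (#L : ℝ) := by
  simp [sum_ite_mem]

end PairedSums

lemma le_colorAvg_sum_walsh_pow_four {ι : Type*} [DecidableEq ι] [Fintype ι]
    (L : Finset (Finset ι)) :
    3 * (#L : ℝ) ^ 2 - 2 * #L ≤ colorAvg fun c ↦ (∑ F ∈ L, walsh F c) ^ 4 := by
  rw [colorAvg_sum_walsh_pow_four]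
  nth_rewrite 2 [← sum_all_equal L]
  rw [show 3 * (#L : ℝ) ^ 2 = #L ^ 2 + #L ^ 2 + #L ^ 2 by ring]
  nth_rewrite 1 [← sum_paired₁₂ L]
  nth_rewrite 1 [← sum_paired₁₃ L]
  nth_rewrite 1 [← sum_paired₁₄ L]
  simp only [mul_sum, ← sum_add_distrib, ← sum_sub_distrib]
  refine sum_le_sum fun A _ ↦ sum_le_sum fun B _ ↦ sum_le_sum fun C _ ↦ sum_le_sum fun D _ ↦ ?_
  have h₁ : A = B → C = D → A ∆ B ∆ C ∆ D = ∅ := by rintro rfl rfl; simp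
  have h₂ : A = C → B = D → A ∆ B ∆ C ∆ D = ∅ := by
    rintro rfl rfl; rw [symmDiff_comm A B, symmDiff_assoc B A A]; simp
  have h₃ : A = D → B = C → A ∆ B ∆ C ∆ D = ∅ := by
    rintro rfl rfl; rw [symmDiff_assoc A B B]; simp
  split_ifs <;> first | (norm_num; done) | (exfalso; grind)

lemma colorAvg_sum_cherries_pow_four_le {n : ℕ} (hn : 5 ≤ n) :
    colorAvg (fun c ↦ (∑ F ∈ cherries n, walsh F c) ^ 4) ≤
      3 * (#(cherries n) : ℝ) ^ 2 + 2 ^ 40 * (n : ℝ) ^ 5 := by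
  rw [colorAvg_sum_walsh_pow_four]
  refine le_trans ?_ (add_le_add_right (sum_card_vertexSupport_le_five hn (cherries n)) _)
  rw [show 3 * (#(cherries n) : ℝ) ^ 2 =
    #(cherries n) ^ 2 + #(cherries n) ^ 2 + #(cherries n) ^ 2 by ring]
  nth_rewrite 1 [← sum_paired₁₂ (cherries n)]
  nth_rewrite 1 [← sum_paired₁₃ (cherries n)]
  nth_rewrite 1 [← sum_paired₁₄ (cherries n)]
  simp only [← sum_add_distrib]
  refine sum_le_sum fun A hA ↦ sum_le_sum fun B hB ↦ sum_le_sum fun C hC ↦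
    sum_le_sum fun D hD ↦ ?_
  have h₁ : A ∆ B ∆ C ∆ D = ∅ → A = B → C = D := by
    rintro h rfl
    rw [symmDiff_self, bot_symmDiff] at h
    exact symmDiff_eq_bot.1 h
  have h₂ : A ∆ B ∆ C ∆ D = ∅ → A = C → B = D := by
    rintro h rfl
    rw [symmDiff_comm A B, symmDiff_assoc B A A, symmDiff_self, symmDiff_bot] at h
    exact symmDiff_eq_bot.1 h
  have h₃ : A ∆ B ∆ C ∆ D = ∅ → A = D → B = C := by
    rintro h rfl
    rw [symmDiff_assoc A B C, symmDiff_comm A, symmDiff_assoc, symmDiff_self, symmDiff_bot] at h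
    exact symmDiff_eq_bot.1 h
  have h₄ := card_vertexSupport_le_five hA hB hC hD
  split_ifs <;> first | (norm_num; done) | (exfalso; grind)

section WalshExpansion

/-- The indicator that a nonempty set of coordinates is monochromatic, expanded over its even
subsets. -/
lemma indicator_monochromatic {ι : Type*} [DecidableEq ι] {E : Finset ι} (hE : E.Nonempty)
    (c : ι → Bool) :
    (if ∃ b : Bool, ∀ e ∈ E, c e = b then (1 : ℝ) else 0) =
      2 / 2 ^ #E * ∑ F ∈ E.powerset, if Even #F then walsh F c else 0 := by
  have plus : ∏ e ∈ E, (1 + boolSign (c e)) = ∑ F ∈ E.powerset, walsh F c := prod_one_add E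
  have minus : ∏ e ∈ E, (1 + -boolSign (c e)) = ∑ F ∈ E.powerset, (-1) ^ #F * walsh F c := by
    rw [prod_one_add]
    exact sum_congr rfl fun F _ ↦ by rw [walsh, prod_neg]
  have even_part : 2 * ∑ F ∈ E.powerset, (if Even #F then walsh F c else 0) =
      ∏ e ∈ E, (1 + boolSign (c e)) + ∏ e ∈ E, (1 + -boolSign (c e)) := by
    rw [plus, minus, mul_sum, ← sum_add_distrib]
    refine sum_congr rfl fun F _ ↦ ?_
    split_ifs with h
    · rw [h.neg_one_pow]; ring
    · rw [(Nat.not_even_iff_odd.1 h).neg_one_pow]; ring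
  have prod_true : ∏ e ∈ E, (1 + boolSign (c e)) = if ∀ e ∈ E, c e = true then 2 ^ #E else 0 := by
    split_ifs with h
    · rw [prod_congr rfl fun e he ↦ by rw [h e he, boolSign, if_pos rfl, one_add_one_eq_two],
        prod_const]
    · push Not at h
      obtain ⟨e, he, hc⟩ := h
      exact prod_eq_zero he (by simp [boolSign, hc])
  have prod_false :
      ∏ e ∈ E, (1 + -boolSign (c e)) = if ∀ e ∈ E, c e = false then 2 ^ #E else 0 := by
    split_ifs with h
    · rw [prod_congr rfl fun e he ↦ show _ = (2 : ℝ) by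
        rw [h e he, boolSign, if_neg Bool.false_ne_true, neg_neg, one_add_one_eq_two], prod_const]
    · push Not at h
      obtain ⟨e, he, hc⟩ := h
      exact prod_eq_zero he (by simp [boolSign, hc])
  rw [div_mul_eq_mul_div, even_part, prod_true, prod_false]
  obtain ⟨e, he⟩ := hE
  by_cases ht : ∀ e ∈ E, c e = true
  · have hf : ¬ ∀ e ∈ E, c e = false := fun hf ↦ by simpa [ht e he] using hf e he
    rw [if_pos ⟨true, ht⟩, if_pos ht, if_neg hf, add_zero, div_self (by positivity)]
  · by_cases hf : ∀ e ∈ E, c e = false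
    · rw [if_pos ⟨false, hf⟩, if_neg ht, if_pos hf, zero_add, div_self (by positivity)]
    · rw [if_neg, if_neg ht, if_neg hf, add_zero, zero_div]
      rintro ⟨_ | _, hb⟩
      · exact hf hb
      · exact ht hb

variable {n : ℕ}

/-- The number of `k`-sets of vertices containing all the edges in `F`. -/
def extensionCount (k : ℕ) (F : Finset (CompleteEdge n)) : ℕ :=
  #((powersetCard k univ).filter fun S ↦ vertexSupport F ⊆ S)

lemma extensionCount_eq_choose {k : ℕ} {F : Finset (CompleteEdge n)}
    (hF : #(vertexSupport F) ≤ k) :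
    extensionCount k F = (n - #(vertexSupport F)).choose (k - #(vertexSupport F)) := by
  rw [extensionCount, card_filter_powersetCard_subset _ _ _ (subset_univ _) hF, card_univ,
    Fintype.card_fin]

lemma extensionCount_eq_zero {k : ℕ} {F : Finset (CompleteEdge n)}
    (hF : k < #(vertexSupport F)) : extensionCount k F = 0 := by
  refine card_eq_zero.2 (filter_eq_empty_iff.2 fun S hS hFS ↦ ?_)
  have := card_le_card hFS
  rw [(mem_powersetCard.1 hS).2] at this
  omega

lemma sum_extensionCount (k : ℕ) :
    ∑ F : Finset (CompleteEdge n), extensionCount k F = n.choose k * 2 ^ k.choose 2 := by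
  simp only [extensionCount, card_filter]
  rw [sum_comm]
  have inner : ∀ S ∈ powersetCard k (univ : Finset (Fin n)),
      ∑ F : Finset (CompleteEdge n), (if vertexSupport F ⊆ S then 1 else 0) = 2 ^ k.choose 2 := by
    intro S hS
    rw [← card_filter, ← (mem_powersetCard.1 hS).2, ← card_edgesIn, ← card_powerset]
    congr 1
    ext F
    simp [subset_edgesIn]
  rw [sum_congr rfl inner, sum_const, card_powersetCard, card_univ, Fintype.card_fin, smul_eq_mul]

lemma monoCount_eq_sum_walsh {k : ℕ} (hk : 2 ≤ k) (c : EdgeColoring n) :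
    (monoCount n k c : ℝ) = 2 / 2 ^ k.choose 2 *
      ∑ F : Finset (CompleteEdge n), (if Even #F then (extensionCount k F : ℝ) else 0) *
        walsh F c := by
  have indicator : ∀ S ∈ powersetCard k (univ : Finset (Fin n)),
      (if ∃ b : Bool, ∀ e : CompleteEdge n, e.1 ⊆ S → c e = b then (1 : ℝ) else 0) =
        2 / 2 ^ k.choose 2 * ∑ F : Finset (CompleteEdge n),
          if vertexSupport F ⊆ S then (if Even #F then walsh F c else 0) else 0 := by
    intro S hS
    have hcard : #(edgesIn S) = k.choose 2 := by rw [card_edgesIn, (mem_powersetCard.1 hS).2]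
    have hne : (edgesIn S).Nonempty := card_pos.1 (hcard ▸ Nat.choose_pos hk)
    have := indicator_monochromatic hne c
    simp only [mem_edgesIn] at this
    have hpow : (edgesIn S).powerset = univ.filter (vertexSupport · ⊆ S) := by
      ext F
      simp [subset_edgesIn]
    rw [this, hcard, hpow, sum_filter]
  rw [monoCount, card_filter, Nat.cast_sum]
  simp only [Nat.cast_ite, Nat.cast_one, Nat.cast_zero]
  rw [sum_congr rfl indicator, ← mul_sum, sum_comm]
  congr 1
  refine sum_congr rfl fun F _ ↦ ?_
  rw [← sum_filter, sum_const, nsmul_eq_mul, extensionCount]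
  split_ifs <;> simp

/-- The Walsh coefficients supported on at least four vertices. -/
def remainderCoeff (k : ℕ) (F : Finset (CompleteEdge n)) : ℝ :=
  if Even #F ∧ 4 ≤ #(vertexSupport F) then (extensionCount k F : ℝ) else 0

/-- The sum of the Walsh characters of all cherries. -/
def cherrySum (c : CompleteEdge n → Bool) : ℝ := ∑ F ∈ cherries n, walsh F c

/-- The part of the Walsh expansion supported on at least four vertices. -/
def remainderSum (k : ℕ) (c : CompleteEdge n → Bool) : ℝ :=
  ∑ F : Finset (CompleteEdge n), remainderCoeff k F * walsh F c

lemma monoCount_eq_main_add_remainder {k : ℕ} (hk : 3 ≤ k) (c : EdgeColoring n) :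
    (monoCount n k c : ℝ) = 2 / 2 ^ k.choose 2 * (n.choose k +
      ((n - 3).choose (k - 3) * cherrySum c + remainderSum k c)) := by
  have cherry : cherrySum c =
      ∑ F : Finset (CompleteEdge n), if F ∈ cherries n then walsh F c else 0 := by
    rw [cherrySum, sum_ite_mem, univ_inter]
  have const : (n.choose k : ℝ) =
      ∑ F : Finset (CompleteEdge n), if F = ∅ then (n.choose k : ℝ) else 0 := by simp
  rw [monoCount_eq_sum_walsh (by omega), cherry, const, remainderSum]
  congr 1
  rw [mul_sum, ← sum_add_distrib, ← sum_add_distrib]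
  refine sum_congr rfl fun F _ ↦ ?_
  rw [remainderCoeff]
  by_cases hF : F = ∅
  · subst hF
    have h₀ : (∅ : Finset (CompleteEdge n)) ∉ cherries n := by simp [mem_cherries]
    have hV : vertexSupport (∅ : Finset (CompleteEdge n)) = ∅ := by simp [vertexSupport]
    simp [h₀, hV, extensionCount]
  · have hpos : 0 < #F := card_pos.2 (nonempty_iff_ne_empty.2 hF)
    by_cases he : Even #F
    · have hV : 3 ≤ #(vertexSupport F) :=
        three_le_card_vertexSupport (by obtain ⟨r, hr⟩ := he; omega)
      by_cases h₃ : #(vertexSupport F) = 3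
      · simp [hF, he, mem_cherries_of_even he h₃, h₃, extensionCount_eq_choose (h₃.trans_le hk)]
      · have hc : F ∉ cherries n := fun h ↦ h₃ (mem_cherries.1 h).2
        have h₄ : 4 ≤ #(vertexSupport F) := by omega
        simp [hF, he, hc, h₄]
    · have hc : F ∉ cherries n := fun h ↦ he ((mem_cherries.1 h).1 ▸ even_two)
      simp [hF, he, hc]

lemma colorAvg_sum_mul_walsh {ι : Type*} [DecidableEq ι] [Fintype ι] (s : Finset (Finset ι))
    (hs : ∅ ∉ s) (a : Finset ι → ℝ) : colorAvg (fun c ↦ ∑ F ∈ s, a F * walsh F c) = 0 := by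
  simp only [colorAvg_sum, colorAvg_const_mul, colorAvg_walsh]
  refine sum_eq_zero fun F hF ↦ ?_
  have hne : F ≠ ∅ := fun h ↦ hs (h ▸ hF)
  rw [if_neg hne, mul_zero]

lemma colorAvg_cherrySum : colorAvg (cherrySum (n := n)) = 0 := by
  have := colorAvg_sum_mul_walsh (cherries n) (by simp [mem_cherries]) 1
  simp only [Pi.one_apply, one_mul] at this
  exact this

lemma colorAvg_remainderSum (k : ℕ) : colorAvg (remainderSum (n := n) k) = 0 := by
  rw [← colorAvg_sum_mul_walsh (univ.erase ∅) (notMem_erase _ _) (remainderCoeff (n := n) k)]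
  congr 1
  funext c
  refine (sum_erase _ ?_).symm
  simp [remainderCoeff, vertexSupport]

lemma expec_eq_colorAvg (f : EdgeColoring n → ℝ) : expec n f = colorAvg f := rfl

lemma centralMoment_eq {k : ℕ} (hk : 3 ≤ k) (m : ℕ) :
    centralMoment n k m = (2 / 2 ^ k.choose 2) ^ m * colorAvg fun c ↦
      ((n - 3).choose (k - 3) * cherrySum (n := n) c + remainderSum k c) ^ m := by
  have mean : colorAvg (fun c : EdgeColoring n ↦ (monoCount n k c : ℝ)) =
      2 / 2 ^ k.choose 2 * n.choose k := by
    simp only [monoCount_eq_main_add_remainder hk]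
    rw [colorAvg_const_mul, colorAvg_add, colorAvg_add, colorAvg_const, colorAvg_const_mul,
      colorAvg_cherrySum, colorAvg_remainderSum]
    ring
  simp only [centralMoment, expec_eq_colorAvg]
  rw [mean, ← colorAvg_const_mul]
  congr 1
  funext c
  rw [monoCount_eq_main_add_remainder hk, ← mul_sub, add_sub_cancel_left, mul_pow]

lemma mul_extensionCount_le {k : ℕ} {F : Finset (CompleteEdge n)}
    (hF : 4 ≤ #(vertexSupport F)) : n * extensionCount k F ≤ n ^ (k - 3) := by
  by_cases hk : #(vertexSupport F) ≤ k
  · have hn : 0 < n := by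
      have := card_le_univ (vertexSupport F)
      rw [Fintype.card_fin] at this
      omega
    calc n * extensionCount k F
        ≤ n * n ^ (k - #(vertexSupport F)) := by
          rw [extensionCount_eq_choose hk]
          exact Nat.mul_le_mul_left _ ((Nat.choose_le_pow _ _).trans
            (Nat.pow_le_pow_left (Nat.sub_le _ _) _))
      _ = n ^ (k - #(vertexSupport F) + 1) := (pow_succ' _ _).symm
      _ ≤ n ^ (k - 3) := Nat.pow_le_pow_right hn (by omega)
  · simp [extensionCount_eq_zero (not_le.1 hk)]

lemma card_le_of_extensionCount_ne_zero {k : ℕ} {F : Finset (CompleteEdge n)}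
    (hF : extensionCount k F ≠ 0) : #F ≤ k.choose 2 :=
  (card_le_choose_vertexSupport F).trans <| Nat.choose_le_choose 2 <|
    not_lt.1 fun h ↦ hF (extensionCount_eq_zero h)

lemma mul_sum_remainderCoeff_sq_le {k : ℕ} :
    n * ∑ F : Finset (CompleteEdge n), 3 ^ #F * remainderCoeff k F ^ 2 ≤
      (6 : ℝ) ^ k.choose 2 * n ^ (k - 3) * n ^ k := by
  have term (F : Finset (CompleteEdge n)) : n * (3 ^ #F * remainderCoeff k F ^ 2) ≤
      3 ^ k.choose 2 * n ^ (k - 3) * (extensionCount k F : ℝ) := by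
    rw [remainderCoeff]
    split_ifs with h
    · by_cases h₀ : extensionCount k F = 0
      · simp [h₀]
      · have h₁ : (n : ℝ) * extensionCount k F ≤ n ^ (k - 3) := by
          exact_mod_cast mul_extensionCount_le h.2
        have h₂ : (3 : ℝ) ^ #F ≤ 3 ^ k.choose 2 :=
          pow_le_pow_right₀ (by norm_num) (card_le_of_extensionCount_ne_zero h₀)
        calc (n : ℝ) * (3 ^ #F * (extensionCount k F : ℝ) ^ 2)
            = 3 ^ #F * (n * extensionCount k F) * extensionCount k F := by ring
          _ ≤ _ := by gcongr
    · rw [zero_pow two_ne_zero, mul_zero, mul_zero]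
      positivity
  have total : ∑ F : Finset (CompleteEdge n), (extensionCount k F : ℝ) ≤
      2 ^ k.choose 2 * n ^ k := by
    rw [mul_comm]
    have := (sum_extensionCount (n := n) k).trans_le
      (Nat.mul_le_mul_right _ (Nat.choose_le_pow n k))
    exact_mod_cast this
  calc n * ∑ F : Finset (CompleteEdge n), 3 ^ #F * remainderCoeff k F ^ 2
      ≤ 3 ^ k.choose 2 * n ^ (k - 3) * ∑ F : Finset (CompleteEdge n), (extensionCount k F : ℝ) := by
        rw [mul_sum, mul_sum]
        exact sum_le_sum fun F _ ↦ term F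
    _ ≤ 3 ^ k.choose 2 * n ^ (k - 3) * (2 ^ k.choose 2 * n ^ k) := by gcongr
    _ = _ := by
        rw [show (6 : ℝ) = 3 * 2 by norm_num, mul_pow]
        ring

lemma sq_mul_colorAvg_remainderSum_pow_four_le {k : ℕ} (hk : 3 ≤ k) :
    (n : ℝ) ^ 2 * colorAvg (fun c ↦ remainderSum (n := n) k c ^ 4) ≤
      36 ^ k.choose 2 * n ^ (4 * k - 6) := by
  have h := colorAvg_pow_four_le (univ : Finset (CompleteEdge n)) (remainderCoeff k)
  rw [powerset_univ] at h
  calc (n : ℝ) ^ 2 * colorAvg (fun c ↦ remainderSum (n := n) k c ^ 4)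
      ≤ (n * ∑ F : Finset (CompleteEdge n), 3 ^ #F * remainderCoeff k F ^ 2) ^ 2 := by
        rw [mul_pow]
        gcongr
        exact h
    _ ≤ ((6 : ℝ) ^ k.choose 2 * n ^ (k - 3) * n ^ k) ^ 2 := by
        refine pow_le_pow_left₀ ?_ mul_sum_remainderCoeff_sq_le 2
        exact mul_nonneg (Nat.cast_nonneg n) (sum_nonneg fun F _ ↦ by positivity)
    _ = 36 ^ k.choose 2 * n ^ (4 * k - 6) := by
        rw [show (36 : ℝ) = 6 ^ 2 by norm_num, show 4 * k - 6 = (k - 3 + k) * 2 by omega,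
          mul_assoc, ← pow_add, mul_pow, ← pow_mul, ← pow_mul, ← pow_mul, mul_comm 2]

end WalshExpansion

section Asymptotics

lemma tendsto_choose_div_pow (j : ℕ) :
    Tendsto (fun n : ℕ ↦ (n.choose j : ℝ) / (n : ℝ) ^ j) atTop (𝓝 (1 / (j.factorial : ℝ))) := by
  have hpos : ∀ᶠ n : ℕ in atTop, (n : ℝ) ^ j / (j.factorial : ℝ) ≠ 0 := by
    filter_upwards [eventually_gt_atTop 0] with n hn
    positivity
  have h := (Asymptotics.isEquivalent_iff_tendsto_one hpos).1 (isEquivalent_choose j)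
  have h' := h.mul_const (1 / (j.factorial : ℝ))
  rw [one_mul] at h'
  refine h'.congr' ?_
  filter_upwards [eventually_gt_atTop 0] with n hn
  simp only [Pi.div_apply]
  field_simp

lemma tendsto_sub_three_choose_div_pow (j : ℕ) :
    Tendsto (fun n : ℕ ↦ ((n - 3).choose j : ℝ) / (n : ℝ) ^ j) atTop
      (𝓝 (1 / (j.factorial : ℝ))) := by
  have ratio : Tendsto (fun n : ℕ ↦ ((n - 3 : ℕ) : ℝ) / n) atTop (𝓝 1) := by
    have h := (tendsto_const_div_atTop_nhds_zero_nat (3 : ℝ)).const_sub 1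
    rw [sub_zero] at h
    refine h.congr' ?_
    filter_upwards [eventually_ge_atTop 3] with n hn
    have : (n : ℝ) ≠ 0 := by positivity
    rw [Nat.cast_sub hn]
    field_simp
    norm_num
  have h := ((tendsto_choose_div_pow j).comp (tendsto_sub_atTop_nat 3)).mul (ratio.pow j)
  rw [one_pow, mul_one] at h
  refine h.congr' ?_
  filter_upwards [eventually_gt_atTop 3] with n hn
  have h₁ : ((n - 3 : ℕ) : ℝ) ≠ 0 := by
    have : n - 3 ≠ 0 := by omega
    exact_mod_cast this
  simp only [Function.comp_apply, div_pow]
  field_simp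

lemma tendsto_colorAvg_cherrySum_pow_four :
    Tendsto (fun n : ℕ ↦ colorAvg (fun c ↦ cherrySum (n := n) c ^ 4) / (n : ℝ) ^ 6) atTop
      (𝓝 (3 / 4)) := by
  have hN : Tendsto (fun n : ℕ ↦ (#(cherries n) : ℝ) / (n : ℝ) ^ 3) atTop (𝓝 (1 / 2)) := by
    have h := (tendsto_choose_div_pow 3).const_mul 3
    norm_num [Nat.factorial] at h
    refine Tendsto.congr (fun n ↦ ?_) (by norm_num; exact h)
    rw [card_cherries]
    push_cast
    ring
  have inv_zero (a : ℝ) (j : ℕ) (hj : j ≠ 0) :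
      Tendsto (fun n : ℕ ↦ a / (n : ℝ) ^ j) atTop (𝓝 0) :=
    tendsto_const_nhds.div_atTop
      ((tendsto_pow_atTop hj).comp tendsto_natCast_atTop_atTop)
  have lower := ((hN.pow 2).const_mul 3).sub (hN.mul (inv_zero 2 3 (by norm_num)))
  have upper := ((hN.pow 2).const_mul 3).add (inv_zero (2 ^ 40) 1 (by norm_num))
  refine tendsto_of_tendsto_of_tendsto_of_le_of_le' (by convert lower using 2; norm_num)
    (by convert upper using 2; norm_num) ?_ ?_
  · filter_upwards [eventually_gt_atTop 0] with n hn
    have hn' : (0 : ℝ) < n := by positivity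
    rw [le_div_iff₀ (by positivity)]
    refine le_trans (le_of_eq ?_) (le_colorAvg_sum_walsh_pow_four (cherries n))
    field_simp
  · filter_upwards [eventually_ge_atTop 5] with n hn
    have hn' : (0 : ℝ) < n := by positivity
    rw [div_le_iff₀ (by positivity)]
    refine (colorAvg_sum_cherries_pow_four_le hn).trans (le_of_eq ?_)
    field_simp

lemma abs_add_mul_pow_four_sub_le {s : ℝ} (hs₀ : 0 ≤ s) (hs₁ : s ≤ 1) (x z : ℝ) :
    |(x + s * z) ^ 4 - x ^ 4| ≤ 15 * s * (x ^ 4 + z ^ 4) := by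
  have hsq : x ^ 2 * z ^ 2 ≤ x ^ 4 + z ^ 4 := by
    nlinarith [sq_nonneg (x ^ 2 - z ^ 2), sq_nonneg (x ^ 2), sq_nonneg (z ^ 2)]
  have h₁ : |x ^ 3 * z| ≤ x ^ 4 + z ^ 4 := by
    rw [abs_le]
    constructor <;> nlinarith [sq_nonneg (x ^ 2 - x * z), sq_nonneg (x ^ 2 + x * z),
      sq_nonneg (x ^ 2), sq_nonneg (z ^ 2)]
  have h₃ : |x * z ^ 3| ≤ x ^ 4 + z ^ 4 := by
    rw [abs_le]
    constructor <;> nlinarith [sq_nonneg (z ^ 2 - x * z), sq_nonneg (z ^ 2 + x * z),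
      sq_nonneg (x ^ 2), sq_nonneg (z ^ 2)]
  have hP : 0 ≤ x ^ 4 + z ^ 4 := by positivity
  have h₂ : |x ^ 2 * z ^ 2| ≤ x ^ 4 + z ^ 4 := by rwa [abs_of_nonneg (by positivity)]
  have h₄ : |z ^ 4| ≤ x ^ 4 + z ^ 4 := by
    rw [abs_of_nonneg (by positivity)]
    nlinarith [sq_nonneg (x ^ 2)]
  have scale {j : ℕ} (hj : j ≠ 0) (a : ℝ) {w : ℝ} (ha : 0 ≤ a) (hw : |w| ≤ x ^ 4 + z ^ 4) :
      |a * s ^ j * w| ≤ a * s * (x ^ 4 + z ^ 4) := by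
    rw [abs_mul, abs_of_nonneg (by positivity)]
    have := pow_le_of_le_one hs₀ hs₁ hj
    gcongr
  have e : (x + s * z) ^ 4 - x ^ 4 = 4 * s ^ 1 * (x ^ 3 * z) + 6 * s ^ 2 * (x ^ 2 * z ^ 2) +
      4 * s ^ 3 * (x * z ^ 3) + 1 * s ^ 4 * z ^ 4 := by ring
  rw [e]
  have t₁ := scale one_ne_zero 4 (by norm_num) h₁
  have t₂ := scale two_ne_zero 6 (by norm_num) h₂
  have t₃ := scale three_ne_zero 4 (by norm_num) h₃
  have t₄ := scale four_ne_zero 1 (by norm_num) h₄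
  have a₁ := abs_add_le (4 * s ^ 1 * (x ^ 3 * z)) (6 * s ^ 2 * (x ^ 2 * z ^ 2))
  have a₂ := abs_add_le (4 * s ^ 1 * (x ^ 3 * z) + 6 * s ^ 2 * (x ^ 2 * z ^ 2))
    (4 * s ^ 3 * (x * z ^ 3))
  have a₃ := abs_add_le (4 * s ^ 1 * (x ^ 3 * z) + 6 * s ^ 2 * (x ^ 2 * z ^ 2) +
    4 * s ^ 3 * (x * z ^ 3)) (1 * s ^ 4 * z ^ 4)
  linarith

lemma abs_colorAvg_add_mul_pow_four_sub_le {ι : Type*} [DecidableEq ι] [Fintype ι] {s : ℝ}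
    (hs₀ : 0 ≤ s) (hs₁ : s ≤ 1) (f g : (ι → Bool) → ℝ) :
    |colorAvg (fun c ↦ (f c + s * g c) ^ 4) - colorAvg (fun c ↦ f c ^ 4)| ≤
      15 * s * (colorAvg (fun c ↦ f c ^ 4) + colorAvg (fun c ↦ g c ^ 4)) := by
  rw [← colorAvg_add, ← colorAvg_const_mul]
  simp only [colorAvg, ← sub_div, ← sum_sub_distrib, abs_div, Nat.abs_cast]
  gcongr
  exact (abs_sum_le_sum_abs _ _).trans
    (sum_le_sum fun c _ ↦ abs_add_mul_pow_four_sub_le hs₀ hs₁ (f c) (g c))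

lemma tendsto_colorAvg_main_add_remainder {k : ℕ} (hk : 3 ≤ k) :
    Tendsto (fun n : ℕ ↦ colorAvg (fun c ↦
        ((n - 3).choose (k - 3) * cherrySum (n := n) c + remainderSum k c) ^ 4) /
          (n : ℝ) ^ (4 * k - 6)) atTop
      (𝓝 (3 / 4 * (1 / ((k - 3).factorial : ℝ) ^ 4))) := by
  set main : ℕ → ℝ := fun n ↦ colorAvg (fun c ↦
    ((n - 3).choose (k - 3) * cherrySum (n := n) c) ^ 4) / (n : ℝ) ^ (4 * k - 6) with hmain
  have main_lim : Tendsto main atTop (𝓝 (3 / 4 * (1 / ((k - 3).factorial : ℝ) ^ 4))) := by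
    have h := tendsto_colorAvg_cherrySum_pow_four.mul
      ((tendsto_sub_three_choose_div_pow (k - 3)).pow 4)
    rw [div_pow, one_pow] at h
    refine h.congr fun n ↦ ?_
    simp only [hmain, mul_pow, colorAvg_const_mul]
    rw [div_pow, ← pow_mul, div_mul_div_comm, ← pow_add,
      show 6 + (k - 3) * 4 = 4 * k - 6 by omega, mul_comm]
  have s_lim : Tendsto (fun n : ℕ ↦ (√(n : ℝ))⁻¹) atTop (𝓝 0) :=
    tendsto_inv_atTop_zero.comp (Real.tendsto_sqrt_atTop.comp tendsto_natCast_atTop_atTop)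
  have err_lim : Tendsto (fun n : ℕ ↦ 15 * (√(n : ℝ))⁻¹ * (main n + 36 ^ k.choose 2)) atTop
      (𝓝 0) := by
    simpa using (s_lim.const_mul 15).mul (main_lim.add_const (36 ^ k.choose 2))
  refine (tendsto_iff_of_dist ?_).1 main_lim
  refine squeeze_zero' (Eventually.of_forall fun _ ↦ dist_nonneg) ?_ err_lim
  filter_upwards [eventually_gt_atTop 0] with n hn
  have hn' : (1 : ℝ) ≤ n := by exact_mod_cast hn
  have hD : (0 : ℝ) < (n : ℝ) ^ (4 * k - 6) := by positivity
  have hsqrt : 0 < √(n : ℝ) := Real.sqrt_pos.2 (by positivity)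
  have hs₁ : (√(n : ℝ))⁻¹ ≤ 1 := inv_le_one_of_one_le₀ (Real.one_le_sqrt.2 hn')
  have key := abs_colorAvg_add_mul_pow_four_sub_le (inv_nonneg.2 hsqrt.le) hs₁
    (fun c ↦ (n - 3).choose (k - 3) * cherrySum (n := n) c)
    (fun c ↦ √(n : ℝ) * remainderSum (n := n) k c)
  simp only [inv_mul_cancel_left₀ hsqrt.ne'] at key
  have rem : colorAvg (fun c ↦ (√(n : ℝ) * remainderSum (n := n) k c) ^ 4) ≤
      36 ^ k.choose 2 * (n : ℝ) ^ (4 * k - 6) := by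
    have h4 : √(n : ℝ) ^ 4 = (n : ℝ) ^ 2 := by
      rw [show 4 = 2 * 2 from rfl, pow_mul, Real.sq_sqrt (Nat.cast_nonneg n)]
    simp only [mul_pow, colorAvg_const_mul, h4]
    exact sq_mul_colorAvg_remainderSum_pow_four_le hk
  rw [dist_comm, Real.dist_eq, hmain, ← sub_div, abs_div, abs_of_pos hD, div_le_iff₀ hD, mul_assoc,
    add_mul, div_mul_cancel₀ _ hD.ne']
  exact key.trans (by gcongr)

end Asymptotics

theorem fourth_central_moment_asymptotic (k : ℕ) (hk : 3 ≤ k) :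
    Filter.Tendsto (fun n : ℕ =>
      centralMoment n k 4 /
        ((3 / 4) * (1 / ((k - 3).factorial : ℝ) ^ 4) * (n : ℝ) ^ (4 * k - 6) /
          (2 : ℝ) ^ (4 * k.choose 2 - 4)))
      Filter.atTop (nhds 1) := by
  have h := (tendsto_colorAvg_main_add_remainder hk).div_const
    (3 / 4 * (1 / ((k - 3).factorial : ℝ) ^ 4))
  rw [div_self (by positivity)] at h
  refine h.congr fun n ↦ ?_
  have hK : 4 ≤ 4 * k.choose 2 := by
    have := Nat.choose_pos (show 2 ≤ k by omega)
    omega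
  have hpow : ((2 : ℝ) / 2 ^ k.choose 2) ^ 4 * 2 ^ (4 * k.choose 2 - 4) = 1 := by
    rw [div_pow, ← pow_mul, div_mul_eq_mul_div, ← pow_add, Nat.add_sub_cancel' hK, mul_comm 4,
      div_self (by positivity)]
  rw [centralMoment_eq hk, div_div_eq_mul_div, mul_right_comm, hpow, one_mul, div_div, mul_comm]
end
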